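/- Let m ∈ ℝ, σ > 0 and θ₁, θ₂ ∈ ℝ satisfy σ²(θ₁² + 2θ₂) < 1. Let X and Y be independent real random variables with X distributed as the Gaussian N(m, σ²) and Y distributed as the standard Gaussian N(0, 1). Then E[exp(θ₁XY + θ₂X²)] = (1 − σ²(θ₁² + 2θ₂))^{-1/2} · exp( m²(θ₁² + 2θ₂) / (2(1 − σ²(θ₁² + 2θ₂))) ). -/

import Mathlib

open MeasureTheory ProbabilityTheory Real

/-- Multiplying a Gaussian density by `exp (a x²)` gives a multiple of a Gaussian density. -/
lemma exp_mul_sq_mul_gaussianPDFReal (m a x : ℝ) {v w : NNReal} (hv : v ≠ 0)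
    (h : 2 * v * a < 1) (hw : (w : ℝ) = v / (1 - 2 * v * a)) :
    gaussianPDFReal m v x * Real.exp (a * x ^ 2)
      = ((1 - 2 * v * a) ^ (-(1 : ℝ) / 2) * Real.exp (m ^ 2 * a / (1 - 2 * v * a)))
        * gaussianPDFReal (m / (1 - 2 * v * a)) w x := by
  have hv' : (0 : ℝ) < v := by exact_mod_cast pos_iff_ne_zero.mpr hv
  obtain ⟨D, hD⟩ : ∃ D : ℝ, D = 1 - 2 * v * a := ⟨_, rfl⟩
  have hD0 : 0 < D := by linarith
  have ha : a = (1 - D) / (2 * v) := by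
    field_simp
    linarith
  rw [← hD] at hw ⊢
  have hsqrt : (√(2 * π * v))⁻¹ = D ^ (-(1 : ℝ) / 2) * (√(2 * π * (v / D)))⁻¹ := by
    rw [neg_div, Real.rpow_neg hD0.le, ← Real.sqrt_eq_rpow, ← mul_inv, ← Real.sqrt_mul hD0.le]
    congr 2
    field_simp
  have hexp : -(x - m) ^ 2 / (2 * v) + a * x ^ 2
      = m ^ 2 * a / D + -(x - m / D) ^ 2 / (2 * (v / D)) := by
    rw [ha]
    field_simp
    ring
  rw [gaussianPDFReal, gaussianPDFReal, hw, mul_assoc, ← Real.exp_add, hexp, Real.exp_add, hsqrt]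
  ring

lemma integrable_exp_mul_sq_gaussianReal (m a : ℝ) {v : NNReal} (hv : v ≠ 0)
    (h : 2 * v * a < 1) :
    Integrable (fun x ↦ Real.exp (a * x ^ 2)) (gaussianReal m v) := by
  have hw : ((v / (1 - 2 * v * a).toNNReal : NNReal) : ℝ) = v / (1 - 2 * v * a) := by
    rw [NNReal.coe_div, Real.coe_toNNReal _ (by linarith)]
  rw [gaussianReal_of_var_ne_zero m hv,
    integrable_withDensity_iff_integrable_smul' (measurable_gaussianPDF m v)
      (Filter.Eventually.of_forall fun _ ↦ gaussianPDF_lt_top)]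
  simp only [toReal_gaussianPDF, smul_eq_mul, exp_mul_sq_mul_gaussianPDFReal m a _ hv h hw]
  exact (integrable_gaussianPDFReal _ _).const_mul _

lemma integral_exp_mul_sq_gaussianReal (m a : ℝ) {v : NNReal} (hv : v ≠ 0)
    (h : 2 * v * a < 1) :
    ∫ x, Real.exp (a * x ^ 2) ∂(gaussianReal m v)
      = (1 - 2 * v * a) ^ (-(1 : ℝ) / 2) * Real.exp (m ^ 2 * a / (1 - 2 * v * a)) := by
  have hD : 0 < 1 - 2 * v * a := by linarith
  have hw : ((v / (1 - 2 * v * a).toNNReal : NNReal) : ℝ) = v / (1 - 2 * v * a) := by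
    rw [NNReal.coe_div, Real.coe_toNNReal _ hD.le]
  have hw0 : v / (1 - 2 * v * a).toNNReal ≠ 0 := div_ne_zero hv (Real.toNNReal_pos.mpr hD).ne'
  simp only [integral_gaussianReal_eq_integral_smul hv, smul_eq_mul,
    exp_mul_sq_mul_gaussianPDFReal m a _ hv h hw]
  rw [integral_const_mul, integral_gaussianPDFReal_eq_one _ hw0, mul_one]

lemma integral_exp_mul_add_gaussianReal (t c : ℝ) :
    ∫ y, Real.exp (t * y + c) ∂(gaussianReal 0 1) = Real.exp (t ^ 2 / 2 + c) := by
  have h := congrFun (mgf_fun_id_gaussianReal (μ := 0) (v := 1)) t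
  simp only [mgf, zero_mul, NNReal.coe_one, one_mul, zero_add] at h
  simp only [Real.exp_add, integral_mul_const, h]

/-- MGF of `θ₁ X Y + θ₂ X²` for independent `X ~ N(m, σ²)`, `Y ~ N(0,1)`. -/
theorem stmt_0 (m σ θ₁ θ₂ : ℝ) (hσ : 0 < σ)
    (h : σ ^ 2 * (θ₁ ^ 2 + 2 * θ₂) < 1) :
    ∫ p : ℝ × ℝ, Real.exp (θ₁ * p.1 * p.2 + θ₂ * p.1 ^ 2)
        ∂((gaussianReal m ⟨σ ^ 2, sq_nonneg σ⟩).prod (gaussianReal 0 1))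
      = (1 - σ ^ 2 * (θ₁ ^ 2 + 2 * θ₂)) ^ (-(1 : ℝ) / 2)
        * Real.exp (m ^ 2 * (θ₁ ^ 2 + 2 * θ₂)
            / (2 * (1 - σ ^ 2 * (θ₁ ^ 2 + 2 * θ₂)))) := by
  obtain ⟨v, hv⟩ : ∃ v : NNReal, v = ⟨σ ^ 2, sq_nonneg σ⟩ := ⟨_, rfl⟩
  have hvσ : (v : ℝ) = σ ^ 2 := by rw [hv]; rfl
  rw [← hv]
  have hv0 : v ≠ 0 := by
    rw [← NNReal.coe_ne_zero, hvσ]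
    positivity
  have hva : 2 * v * ((θ₁ ^ 2 + 2 * θ₂) / 2) = σ ^ 2 * (θ₁ ^ 2 + 2 * θ₂) := by
    rw [hvσ]
    ring
  have hlt : 2 * v * ((θ₁ ^ 2 + 2 * θ₂) / 2) < 1 := hva.trans_lt h
  have hinner (x : ℝ) : ∫ y, Real.exp (θ₁ * x * y + θ₂ * x ^ 2) ∂(gaussianReal 0 1)
      = Real.exp ((θ₁ ^ 2 + 2 * θ₂) / 2 * x ^ 2) := by
    rw [integral_exp_mul_add_gaussianReal]
    ring_nf
  have hint : Integrable (fun p : ℝ × ℝ ↦ Real.exp (θ₁ * p.1 * p.2 + θ₂ * p.1 ^ 2))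
      ((gaussianReal m v).prod (gaussianReal 0 1)) := by
    rw [integrable_prod_iff (by fun_prop)]
    constructor
    · refine Filter.Eventually.of_forall fun x ↦ ?_
      simp only [Real.exp_add]
      exact (integrable_exp_mul_gaussianReal _).mul_const _
    · simp only [Real.norm_eq_abs, Real.abs_exp, hinner]
      exact integrable_exp_mul_sq_gaussianReal m _ hv0 hlt
  rw [integral_prod _ hint]
  simp only [hinner]
  rw [integral_exp_mul_sq_gaussianReal m _ hv0 hlt, hva, mul_div_assoc', div_div]
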